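/- For all i, j ∈ I: 𝒩(e_i(0), e_j(−1)) = ⟨[P̄_i], [P̄_j] − Φ^{-1}[P̄_j]⟩, where Φ^{-1} plays the role of the inverse Coxeter transformation c^{-1}. -/

import Mathlib

namespace GQV

open Matrix

/-- Degree shift `η[d]`, i.e. `η[d]ᵢ(a) = ηᵢ(a + d)`. -/
noncomputable def shift {n : ℕ} (η : Fin n × ℝ → ℤ) (d : ℝ) : Fin n × ℝ → ℤ :=
  fun p => η (p.1, p.2 + d)

/-- The q-Cartan operator `C_q`. -/
noncomputable def Cq {n : ℕ} (b : Matrix (Fin n) (Fin n) ℤ) (η : Fin n × ℝ → ℤ) : Fin n × ℝ → ℤ :=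
  fun p =>
    η (p.1, p.2 + 1 / 2) + η (p.1, p.2 - 1 / 2)
      - ∑ i : Fin n, (if i < p.1 then b i p.1 * η (i, p.2 + 1 / 2) else 0)
      - ∑ j : Fin n, (if p.1 < j then b p.1 j * η (j, p.2 - 1 / 2) else 0)

/-- The pairing `η¹ · η² = Σ_{(i,a)} η¹ᵢ(a) η²ᵢ(a)`. -/
noncomputable def dotP {n : ℕ} (η₁ η₂ : Fin n × ℝ → ℤ) : ℤ := ∑ᶠ p, η₁ p * η₂ p

/-- The indicator function `e_{k,a}` of `(k,a)`. -/
noncomputable def eind {n : ℕ} (k : Fin n) (a : ℝ) : Fin n × ℝ → ℤ := fun p => if p = (k, a) then 1 else 0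

/-- Support contained in `I × ℤ`. -/
def SuppInt {n : ℕ} (η : Fin n × ℝ → ℤ) : Prop := ∀ p, η p ≠ 0 → ∃ m : ℤ, p.2 = (m : ℝ)

/-- Support contained in `I × (ℤ + 1/2)`. -/
def SuppHalfInt {n : ℕ} (η : Fin n × ℝ → ℤ) : Prop :=
  ∀ p, η p ≠ 0 → ∃ m : ℤ, p.2 = (m : ℝ) + 1 / 2

/-- The set `E`: functions supported on integer arguments, vanishing for all
sufficiently small arguments. -/
def memE {n : ℕ} (η : Fin n × ℝ → ℤ) : Prop :=
  SuppInt η ∧ ∃ N : ℤ, ∀ (k : Fin n) (a : ℝ), a < (N : ℝ) → η (k, a) = 0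

/-- The set `E[d] = {η[d] : η ∈ E}`. -/
def memEshift {n : ℕ} (d : ℝ) (η : Fin n × ℝ → ℤ) : Prop :=
  ∃ θ, memE θ ∧ η = shift θ d

/-- Functions on `I × (ℤ + 1/2)` vanishing for all sufficiently small arguments;
this is the set `E[1/2] = E[-1/2]`. -/
def memEhalf {n : ℕ} (η : Fin n × ℝ → ℤ) : Prop :=
  SuppHalfInt η ∧ ∃ N : ℤ, ∀ (k : Fin n) (a : ℝ), a < (N : ℝ) → η (k, a) = 0

/-- The strictly upper triangular part `b^>`. -/
def bUpper {n : ℕ} (b : Matrix (Fin n) (Fin n) ℤ) : Matrix (Fin n) (Fin n) ℤ :=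
  Matrix.of fun i j => if i < j then b i j else 0

/-- `E_Q = 1 - b^>`, the matrix of the Euler form. -/
def EQmat {n : ℕ} (b : Matrix (Fin n) (Fin n) ℤ) : Matrix (Fin n) (Fin n) ℤ := 1 - bUpper b

/-- The Euler form `⟨x, y⟩ = xᵀ E_Q y`. -/
def euler {n : ℕ} (b : Matrix (Fin n) (Fin n) ℤ) (x y : Fin n → ℤ) : ℤ :=
  x ⬝ᵥ (EQmat b *ᵥ y)

/-- The class `[Ī_i] = E_Q⁻¹ e_i` of the indecomposable injective with socle `S_i`. -/
noncomputable def Iinj {n : ℕ} (b : Matrix (Fin n) (Fin n) ℤ) (i : Fin n) : Fin n → ℤ :=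
  (EQmat b)⁻¹ *ᵥ Pi.single i 1

/-- The class `[P̄_i] = E_Q⁻ᵀ e_i` of the indecomposable projective with top `S_i`. -/
noncomputable def Pproj {n : ℕ} (b : Matrix (Fin n) (Fin n) ℤ) (i : Fin n) : Fin n → ℤ :=
  ((EQmat b)ᵀ)⁻¹ *ᵥ Pi.single i 1

/-- The Coxeter matrix `Φ = -E_Q⁻¹ E_Qᵀ`. -/
noncomputable def Cox {n : ℕ} (b : Matrix (Fin n) (Fin n) ℤ) : Matrix (Fin n) (Fin n) ℤ :=
  -((EQmat b)⁻¹ * (EQmat b)ᵀ)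

/-- The map `β`, defined `ℤ`-linearly by `β(e_{i,a}) = -Φ^a [Ī_i]` for `a ∈ ℤ`. -/
noncomputable def betaMap {n : ℕ} (b : Matrix (Fin n) (Fin n) ℤ) (η : Fin n × ℝ → ℤ) :
    Fin n → ℤ :=
  ∑ᶠ p : Fin n × ℤ, η (p.1, (p.2 : ℝ)) • ((-(Cox b ^ p.2)) *ᵥ Iinj b p.1)

/-- `𝒩(w¹,w²) = w¹[1/2]·C_q⁻¹w² − w¹[−1/2]·C_q⁻¹w² − w²[1/2]·C_q⁻¹w¹ + w²[−1/2]·C_q⁻¹w¹`,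
where `u₁ = C_q⁻¹ w¹`, `u₂ = C_q⁻¹ w²` are given as arguments. -/
noncomputable def Ncal {n : ℕ} (w₁ w₂ u₁ u₂ : Fin n × ℝ → ℤ) : ℤ :=
  dotP (shift w₁ (1 / 2)) u₂ - dotP (shift w₁ (-(1 / 2))) u₂
    - dotP (shift w₂ (1 / 2)) u₁ + dotP (shift w₂ (-(1 / 2))) u₁

/-- `ℰ'(w¹,w²) = −w¹[1/2]·C_q⁻¹w² + w²[1/2]·C_q⁻¹w¹`, where `u₁ = C_q⁻¹ w¹`,
`u₂ = C_q⁻¹ w²` are given as arguments. -/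
noncomputable def Ecal {n : ℕ} (w₁ w₂ u₁ u₂ : Fin n × ℝ → ℤ) : ℤ :=
  -dotP (shift w₁ (1 / 2)) u₂ + dotP (shift w₂ (1 / 2)) u₁

/-- The B-matrix of the level-1 ice quiver with z-pattern attached to `Q`. -/
def Btilde {n : ℕ} (b : Matrix (Fin n) (Fin n) ℤ) : Matrix (Fin n ⊕ Fin n) (Fin n) ℤ :=
  Matrix.of (Sum.elim (fun i k => b i k)
    (fun j k => -(if j = k then 1 else 0) + (if k < j then b k j else 0)))

/-- The index map: the `ℤ`-linear map on functions supported on `I × {-1, 0}`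
with `ind(e_{k,0}) = e_k` and `ind(e_{k,-1}) = e_{n+k} - e_k`. -/
noncomputable def indMap {n : ℕ} (w : Fin n × ℝ → ℤ) : Fin n ⊕ Fin n → ℤ :=
  Sum.elim (fun k => w (k, 0) - w (k, -1)) (fun k => w (k, -1))

end GQV


open Matrix GQV

theorem aux_det {n : ℕ} (b : Matrix (Fin n) (Fin n) ℤ) : (EQmat b).det = 1 := by
  rw [Matrix.det_of_upperTriangular]
  · apply Finset.prod_eq_one
    intro i _
    simp [EQmat, bUpper]
  · intro i j hij
    have hij' : j < i := hij
    simp [EQmat, bUpper, Matrix.one_apply, hij'.ne', not_lt.mpr hij'.le]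

theorem aux_Cq {n : ℕ} (b : Matrix (Fin n) (Fin n) ℤ) (u : Fin n × ℝ → ℤ) (a : ℝ) :
    (EQmat b)ᵀ *ᵥ (fun k => u (k, a + 1 / 2)) =
      (fun k => Cq b u (k, a)) - EQmat b *ᵥ (fun k => u (k, a - 1 / 2)) := by
  ext k
  simp only [EQmat, Matrix.transpose_sub, Matrix.transpose_one, Matrix.sub_mulVec,
    Matrix.one_mulVec, Pi.sub_apply, Cq]
  simp only [Matrix.mulVec, dotProduct, bUpper, Matrix.transpose_apply, Matrix.of_apply,
    ite_mul, zero_mul]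
  ring

theorem aux_solve {n : ℕ} (b : Matrix (Fin n) (Fin n) ℤ) (u : Fin n × ℝ → ℤ) (a : ℝ) :
    (fun k => u (k, a + 1 / 2)) =
      ((EQmat b)ᵀ)⁻¹ *ᵥ ((fun k => Cq b u (k, a)) - EQmat b *ᵥ (fun k => u (k, a - 1 / 2))) := by
  rw [← aux_Cq, Matrix.mulVec_mulVec, Matrix.nonsing_inv_mul, Matrix.one_mulVec]
  simp [aux_det]

theorem aux_vanish {n : ℕ} (b : Matrix (Fin n) (Fin n) ℤ) (u : Fin n × ℝ → ℤ) (A : ℝ)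
    (hu : memEhalf u) (hA : ∀ k c, c < A → Cq b u (k, c) = 0) (k : Fin n) (a : ℝ)
    (ha : a < A + 1 / 2) : u (k, a) = 0 := by
  obtain ⟨-, N, hN⟩ := hu
  have key : ∀ t : ℕ, ∀ a : ℝ, a < N + t → a < A + 1 / 2 → ∀ k, u (k, a) = 0 := by
    intro t
    induction t with
    | zero => intro a h _ k; exact hN k a (by simpa using h)
    | succ t ih =>
      intro a h h2 k
      have h3 := aux_solve b u (a - 1 / 2)
      have e1 : (fun k => u (k, a - 1 / 2 - 1 / 2)) = 0 := by
        ext k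
        exact ih _ (by push_cast at h; linarith) (by linarith) k
      have e2 : (fun k => Cq b u (k, a - 1 / 2)) = 0 := by
        ext k
        exact hA k _ (by linarith)
      rw [e1, e2] at h3
      have := congrFun h3 k
      simpa using this
  obtain ⟨t, ht⟩ := exists_nat_gt (a - N)
  exact key t a (by linarith) ha k

theorem aux_dot {n : ℕ} (i : Fin n) (c d : ℝ) (u : Fin n × ℝ → ℤ) :
    dotP (shift (eind i c) d) u = u (i, c - d) := by
  unfold dotP
  rw [finsum_eq_single _ (i, c - d)]
  · simp [shift, eind]
  · rintro ⟨k, a⟩ h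
    have : ¬ ((k, a + d) = (i, c)) := by
      intro h'
      apply h
      rw [Prod.mk.injEq] at h' ⊢
      exact ⟨h'.1, by linarith [h'.2]⟩
    simp [shift, eind, this]

theorem aux_first {n : ℕ} (b : Matrix (Fin n) (Fin n) ℤ) (u : Fin n × ℝ → ℤ) (i : Fin n) (c : ℝ)
    (hu : memEhalf u) (h : Cq b u = eind i c) :
    (∀ k a, a < c + 1 / 2 → u (k, a) = 0) ∧ (fun k => u (k, c + 1 / 2)) = Pproj b i := by
  have hv : ∀ k a, a < c + 1 / 2 → u (k, a) = 0 := by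
    intro k a ha
    refine aux_vanish b u c hu ?_ k a ha
    intro k x hx
    simp [h, eind, hx.ne]
  refine ⟨hv, ?_⟩
  rw [aux_solve b u c]
  have e1 : (fun k => u (k, c - 1 / 2)) = 0 := by
    ext k
    exact hv k _ (by linarith)
  have e2 : (fun k => Cq b u (k, c)) = Pi.single i 1 := by
    ext k
    simp [h, eind, Pi.single_apply]
  rw [e1, e2, Matrix.mulVec_zero, sub_zero, Pproj]

theorem aux_cox {n : ℕ} (b : Matrix (Fin n) (Fin n) ℤ) :
    (Cox b)⁻¹ = -(((EQmat b)ᵀ)⁻¹ * EQmat b) := by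
  apply Matrix.inv_eq_right_inv
  have h1 : IsUnit (EQmat b).det := by simp [aux_det]
  have h2 : IsUnit (EQmat b)ᵀ.det := by simp [aux_det]
  rw [Cox, neg_mul_neg, Matrix.mul_assoc, Matrix.mul_nonsing_inv_cancel_left _ _ h2,
    Matrix.nonsing_inv_mul _ h1]

theorem aux_euler {n : ℕ} (b : Matrix (Fin n) (Fin n) ℤ) (i : Fin n) (y : Fin n → ℤ) :
    euler b (Pproj b i) y = y i := by
  have h1 : IsUnit (EQmat b).det := by simp [aux_det]
  rw [euler, Pproj, ← Matrix.transpose_nonsing_inv, Matrix.mulVec_transpose,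
    ← Matrix.dotProduct_mulVec, Matrix.mulVec_mulVec, Matrix.nonsing_inv_mul _ h1]
  simp

/-- `𝒩(e_i(0), e_j(−1)) = ⟨[P̄_i], [P̄_j] − Φ⁻¹[P̄_j]⟩`.
Here `u₁ = C_q⁻¹ e_i(0)` and `u₂ = C_q⁻¹ e_j(−1)`. -/
theorem Ncal_zero_minusone (n : ℕ) (hn : 0 < n) (b : Matrix (Fin n) (Fin n) ℤ)
    (hskew : bᵀ = -b) (hsign : ∀ i j : Fin n, i < j → 0 ≤ b i j)
    (i j : Fin n) (u₁ u₂ : Fin n × ℝ → ℤ)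
    (hu₁ : GQV.memEhalf u₁) (hu₂ : GQV.memEhalf u₂)
    (hu₁Cq : GQV.Cq b u₁ = GQV.eind i (0 : ℝ))
    (hu₂Cq : GQV.Cq b u₂ = GQV.eind j (-1 : ℝ)) :
    GQV.Ncal (GQV.eind i (0 : ℝ)) (GQV.eind j (-1 : ℝ)) u₁ u₂
      = GQV.euler b (GQV.Pproj b i) (GQV.Pproj b j - (GQV.Cox b)⁻¹ *ᵥ GQV.Pproj b j) := by
  obtain ⟨v1, -⟩ := aux_first b u₁ i 0 hu₁ hu₁Cq
  obtain ⟨v2, f2⟩ := aux_first b u₂ j (-1) hu₂ hu₂Cq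
  have g2 := aux_solve b u₂ 0
  have e1 : (fun k => Cq b u₂ (k, (0 : ℝ))) = 0 := by
    ext k
    simp [hu₂Cq, eind]
  have e2 : (fun k => u₂ (k, (0 : ℝ) - 1 / 2)) = Pproj b j := by
    rw [← f2]
    norm_num
  rw [e1, e2] at g2
  rw [Ncal, aux_dot, aux_dot, aux_dot, aux_dot, aux_euler, aux_cox,
    v1 j (-1 - 1 / 2) (by norm_num), v1 j (-1 - -(1 / 2)) (by norm_num)]
  have a1 := congrFun e2 i
  have a2 := congrFun g2 i
  rw [sub_neg_eq_add, a1, a2]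
  simp [Matrix.neg_mulVec, Matrix.mulVec_neg, Matrix.mulVec_mulVec]
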